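/- arXiv:2107.03250 — 2 statements merged into one kernel-verified Lean document; each statement's English description precedes it below -/
import Mathlib

section
/- Let (X, Δ) be a metric space with Borel probability measure μ, Y = {1,…,k} with k ≥ 2, c : X → Y measurable, and let η, η̂ : X → [0,1]^k be measurable with ∫_X ‖η(x) − η̂(x)‖₁ dμ(x) ≤ δ_η for some δ_η ≥ 0. Let G be a countable collection of Borel subsets of X, G' = G ∪ {E ∩ {x : lu(x; c, η̂) > t} : E ∈ G, t ∈ ℚ}, and G_ε = {E_ε : E ∈ G}. Suppose φ is such that for all m, δ: Pr_{S ∼ μ^{⊗m}}[∃A ∈ G' : |μ̂_S(A) − μ(A)| ≥ δ] ≤ φ(m, δ), and φ_ε is such that Pr_{S ∼ μ^{⊗m}}[∃A ∈ G_ε : |μ̂_S(A) − μ(A)| ≥ δ] ≤ φ_ε(m, δ). Then for every γ ≥ 0, ε ≥ 0, α ∈ (0,1], and δ ∈ (0, α/2), with probability at least 1 − 6φ(m, δ) − 2φ_ε(m, δ) over S ∼ μ^{⊗m}: h(μ, c, η, α − δ, γ − δ', ε, G) − δ ≤ h(μ̂_S, c, η̂, α, γ, ε, G) ≤ h(μ,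 c, η, α + δ, γ + δ', ε, G) + δ, where δ' = (4δ + δ_η)/(α − 2δ). -/
open MeasureTheory ProbabilityTheory Metric Set
open scoped ENNReal NNReal

noncomputable section

/-- The pointwise label uncertainty `lu(x; c, η) = 1 - [η(x)]_{c(x)} + max_{y ≠ c(x)} [η(x)]_y`. -/
noncomputable def lu {X : Type*} {k : ℕ} (c : X → Fin k) (η : X → Fin k → ℝ) (x : X) : ℝ :=
  1 - η x (c x) + ⨆ i : {i : Fin k // i ≠ c x}, η x i

/-- The label uncertainty `LU(E; μ, c, η) = (1/μ(E)) ∫_E lu(x; c, η) dμ(x)` of a set `E`. -/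
noncomputable def LU {X : Type*} [MeasurableSpace X] {k : ℕ} (E : Set X) (μ : Measure X)
    (c : X → Fin k) (η : X → Fin k → ℝ) : ℝ :=
  (μ E).toReal⁻¹ * ∫ x in E, lu c η x ∂μ

/-- The empirical measure `μ̂_S = (1/m) ∑ᵢ δ_{xᵢ}` of a finite sample `S`. -/
noncomputable def empMeasure {X : Type*} [MeasurableSpace X] {m : ℕ} (S : Fin m → X) :
    Measure X :=
  (m : ℝ≥0∞)⁻¹ • ∑ i, Measure.dirac (S i)

/-- The label-uncertainty-constrained concentration function
`h(μ, c, η, α, γ, ε, G) = inf {μ(E_ε) : E ∈ G, μ(E) ≥ α, LU(E; μ, c, η) ≥ γ}`,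
with the convention that the infimum of the empty set is `1` (encoded by adjoining `1`;
for probability measures all candidate values lie in `[0,1]`, so this does not change
the infimum of a nonempty candidate set). -/
noncomputable def hConc {X : Type*} [PseudoMetricSpace X] [MeasurableSpace X] {k : ℕ}
    (μ : Measure X) (c : X → Fin k) (η : X → Fin k → ℝ) (α γ ε : ℝ)
    (G : Set (Set X)) : ℝ :=
  sInf ({1} ∪ {r : ℝ | ∃ E ∈ G, α ≤ (μ E).toReal ∧ γ ≤ LU E μ c η ∧
    r = (μ (cthickening ε E)).toReal})

lemma aux_meas {X : Type*} [MeasurableSpace X] (ν μ : Measure X) [IsFiniteMeasure ν]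
    [IsFiniteMeasure μ] (E : Set X) (hE : MeasurableSet E) (f : X → ℝ) (hf : Measurable f)
    (δ : ℝ)
    (h : ∀ t : ℚ, |(ν (E ∩ {x | (t:ℝ) < f x})).toReal - (μ (E ∩ {x | (t:ℝ) < f x})).toReal| ≤ δ)
    (t : ℝ) :
    |(ν.restrict E).real {x | t ≤ f x} - (μ.restrict E).real {x | t ≤ f x}| ≤ δ := by
  obtain ⟨u, hu, hut, hlim⟩ := Real.exists_seq_rat_strictMono_tendsto t
  have hset : E ∩ {x | t ≤ f x} = ⋂ n, E ∩ {x | (u n : ℝ) < f x} := by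
    ext x
    simp only [mem_inter_iff, mem_ofPred_eq, mem_iInter]
    constructor
    · rintro ⟨h1, h2⟩ n
      exact ⟨h1, (hut n).trans_le h2⟩
    · intro h
      exact ⟨(h 0).1, le_of_tendsto' hlim fun n => (h n).2.le⟩
  have hanti : Antitone fun n => E ∩ {x | (u n : ℝ) < f x} := by
    intro a b hab x hx
    simp only [mem_inter_iff, mem_ofPred_eq] at hx ⊢
    refine ⟨hx.1, lt_of_le_of_lt ?_ hx.2⟩
    exact_mod_cast hu.monotone hab
  have key : ∀ (ρ : Measure X) [IsFiniteMeasure ρ], Filter.Tendsto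
      (fun n => (ρ (E ∩ {x | (u n : ℝ) < f x})).toReal) Filter.atTop
      (nhds ((ρ.restrict E).real {x | t ≤ f x})) := by
    intro ρ _
    have h1 : (ρ.restrict E).real {x | t ≤ f x} = (ρ (E ∩ {x | t ≤ f x})).toReal := by
      rw [Measure.real, Measure.restrict_apply (measurableSet_le measurable_const hf), inter_comm]
    rw [h1, hset]
    refine (ENNReal.tendsto_toReal (measure_ne_top _ _)).comp ?_
    exact tendsto_measure_iInter_atTop
      (fun n => (hE.inter (measurableSet_lt measurable_const hf)).nullMeasurableSet)
      hanti ⟨0, measure_ne_top _ _⟩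
  exact le_of_tendsto' ((key ν).sub (key μ)).abs fun n => h (u n)

lemma aux_int {X : Type*} [MeasurableSpace X] (ν μ : Measure X) [IsFiniteMeasure ν]
    [IsFiniteMeasure μ] (E : Set X) (hE : MeasurableSet E) (f : X → ℝ) (hf : Measurable f)
    (hf0 : ∀ x, 0 ≤ f x) (hf2 : ∀ x, f x ≤ 2) (δ : ℝ)
    (h : ∀ t : ℚ, |(ν (E ∩ {x | (t:ℝ) < f x})).toReal - (μ (E ∩ {x | (t:ℝ) < f x})).toReal| ≤ δ) :
    |(∫ x in E, f x ∂ν) - ∫ x in E, f x ∂μ| ≤ 2 * δ := by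
  have key : ∀ (ρ : Measure X) [IsFiniteMeasure ρ],
      IntervalIntegrable (fun t => (ρ.restrict E).real {x | t ≤ f x}) volume 0 2 ∧
      ∫ x in E, f x ∂ρ = ∫ t in (0:ℝ)..2, (ρ.restrict E).real {x | t ≤ f x} := by
    intro ρ _
    constructor
    · apply Antitone.intervalIntegrable
      intro a b hab
      exact measureReal_mono (fun x hx => le_trans hab hx)
    · rw [intervalIntegral.integral_of_le (by norm_num)]
      apply Integrable.integral_eq_integral_Ioc_meas_le
      · exact Integrable.of_bound hf.aestronglyMeasurable 2
          (Filter.Eventually.of_forall fun x => by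
            rw [Real.norm_eq_abs, abs_of_nonneg (hf0 x)]; exact hf2 x)
      · exact Filter.Eventually.of_forall hf0
      · exact Filter.Eventually.of_forall hf2
  rw [(key ν).2, (key μ).2, ← intervalIntegral.integral_sub (key ν).1 (key μ).1]
  have := intervalIntegral.norm_integral_le_of_norm_le_const (a := 0) (b := 2) (C := δ)
    (f := fun t => (ν.restrict E).real {x | t ≤ f x} - (μ.restrict E).real {x | t ≤ f x})
    (fun t _ => aux_meas ν μ E hE f hf δ h t)
  rw [Real.norm_eq_abs] at this
  refine this.trans (le_of_eq ?_)
  norm_num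
  ring

lemma lu_measurable {X : Type*} [MeasurableSpace X] {k : ℕ} (c : X → Fin k) (hc : Measurable c)
    (η : X → Fin k → ℝ) (hη : Measurable η) : Measurable (lu c η) := by
  have h : Measurable (fun p : X × Fin k =>
      1 - η p.1 p.2 + ⨆ i : {i : Fin k // i ≠ p.2}, η p.1 i) := by
    apply measurable_from_prod_countable_left
    intro y
    have h1 : ∀ i, Measurable fun x => η x i := fun i => (measurable_pi_apply i).comp hη
    exact ((measurable_const.sub (h1 y)).add 
      (Measurable.iSup (f := fun (i : {i : Fin k // i ≠ y}) x => η x i) fun i => h1 i))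
  exact h.comp (measurable_id.prodMk hc)

lemma lu_bounds {X : Type*} {k : ℕ} (hk : 2 ≤ k) (c : X → Fin k)
    (η : X → Fin k → ℝ) (h01 : ∀ x i, η x i ∈ Set.Icc (0:ℝ) 1) (x : X) :
    0 ≤ lu c η x ∧ lu c η x ≤ 2 := by
  have h1 := h01 x (c x)
  have h2 : 0 ≤ ⨆ i : {i : Fin k // i ≠ c x}, η x i := Real.iSup_nonneg fun i => (h01 x i).1
  have h3 : (⨆ i : {i : Fin k // i ≠ c x}, η x i) ≤ 1 :=
    Real.iSup_le (fun i => (h01 x i).2) zero_le_one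
  unfold lu
  constructor <;> linarith [h1.1, h1.2]

lemma lu_le {X : Type*} {k : ℕ} (hk : 2 ≤ k) (c : X → Fin k)
    (η η' : X → Fin k → ℝ) (x : X) :
    lu c η x - lu c η' x ≤ ∑ i, |η x i - η' x i| := by
  haveI : Nontrivial (Fin k) := Fin.nontrivial_iff_two_le.mpr hk
  haveI : Nonempty {i : Fin k // i ≠ c x} := by
    obtain ⟨j, hj⟩ := exists_ne (c x)
    exact ⟨⟨j, hj⟩⟩
  have hs : ∑ i, |η x i - η' x i| = |η x (c x) - η' x (c x)|
      + ∑ i ∈ Finset.univ.erase (c x), |η x i - η' x i| :=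
    (Finset.add_sum_erase _ _ (Finset.mem_univ _)).symm
  have h2 : (⨆ i : {i : Fin k // i ≠ c x}, η x i) ≤ (⨆ i : {i : Fin k // i ≠ c x}, η' x i)
      + ∑ i ∈ Finset.univ.erase (c x), |η x i - η' x i| := by
    apply ciSup_le
    intro i
    have a1 : η' x i ≤ ⨆ i : {i : Fin k // i ≠ c x}, η' x i :=
      le_ciSup (f := fun i : {i : Fin k // i ≠ c x} => η' x i) (Set.finite_range _).bddAbove i
    have a2 : |η x i - η' x i| ≤ ∑ i ∈ Finset.univ.erase (c x), |η x i - η' x i| :=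
      Finset.single_le_sum (f := fun i => |η x i - η' x i|) (fun _ _ => abs_nonneg _)
        (Finset.mem_erase.mpr ⟨i.2, Finset.mem_univ _⟩)
    linarith [le_abs_self (η x i - η' x i)]
  have h3 := neg_abs_le (η x (c x) - η' x (c x))
  unfold lu
  linarith

lemma lu_abs_le {X : Type*} {k : ℕ} (hk : 2 ≤ k) (c : X → Fin k)
    (η η' : X → Fin k → ℝ) (x : X) :
    |lu c η x - lu c η' x| ≤ ∑ i, |η x i - η' x i| := by
  rw [abs_le]
  refine ⟨?_, lu_le hk c η η' x⟩
  have := lu_le hk c η' η x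
  simp only [abs_sub_comm (η' x _)] at this
  linarith

lemma emp_le_one {X : Type*} [MeasurableSpace X] {m : ℕ} (S : Fin m → X) (A : Set X) :
    empMeasure S A ≤ 1 := by
  refine (measure_mono (subset_univ A)).trans ?_
  simp only [empMeasure, Measure.smul_apply, Measure.finsetSum_apply, measure_univ,
    Finset.sum_const, Finset.card_univ, Fintype.card_fin, smul_eq_mul, nsmul_eq_mul, mul_one]
  exact ENNReal.inv_mul_le_one _

lemma aux_arith {a b p q b' δ δη D : ℝ} (hD : 0 < D) (hq : D ≤ q) (hp : 0 < p) (hδ : 0 ≤ δ)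
    (hδη : 0 ≤ δη) (hab : |a - b| ≤ 2 * δ) (hbb : |b' - b| ≤ δη) (hpq : |p - q| ≤ δ)
    (ha0 : 0 ≤ a) (ha : a ≤ 2 * p) :
    |p⁻¹ * a - q⁻¹ * b'| ≤ (4 * δ + δη) / D := by
  have hq0 : 0 < q := hD.trans_le hq
  have h0 : 0 ≤ p⁻¹ * a := by positivity
  have h2 : p⁻¹ * a ≤ 2 := by
    rw [inv_mul_le_iff₀ hp]; linarith
  have e : p⁻¹ * a - q⁻¹ * b' = ((a - b) - (b' - b) - (p⁻¹ * a) * (p - q)) / q := by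
    field_simp
    ring
  rw [e, abs_div, abs_of_pos hq0]
  have h3 : |(p⁻¹ * a) * (p - q)| ≤ 2 * δ := by
    rw [abs_mul, abs_of_nonneg h0]
    exact mul_le_mul h2 hpq (abs_nonneg _) (by norm_num)
  have h4 : |(a - b) - (b' - b) - (p⁻¹ * a) * (p - q)| ≤ 4 * δ + δη := by
    rw [abs_le] at *
    constructor <;> linarith [hab.1, hab.2, hbb.1, hbb.2, h3.1, h3.2]
  exact div_le_div₀ (by positivity) h4 hD hq

lemma hConc_le {X : Type*} [PseudoMetricSpace X] [MeasurableSpace X] {k : ℕ}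
    (μ ν : Measure X) (c : X → Fin k) (η η' : X → Fin k → ℝ) (α γ α' γ' ε δ : ℝ)
    (hδ : 0 ≤ δ) (G : Set (Set X))
    (h : ∀ E ∈ G, α' ≤ (ν E).toReal → γ' ≤ LU E ν c η' →
      α ≤ (μ E).toReal ∧ γ ≤ LU E μ c η ∧
        (μ (cthickening ε E)).toReal ≤ (ν (cthickening ε E)).toReal + δ) :
    hConc μ c η α γ ε G ≤ hConc ν c η' α' γ' ε G + δ := by
  rw [← sub_le_iff_le_add]
  have hb : BddBelow ({1} ∪ {r : ℝ | ∃ E ∈ G, α ≤ (μ E).toReal ∧ γ ≤ LU E μ c η ∧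
    r = (μ (cthickening ε E)).toReal}) := by
    refine ⟨0, ?_⟩
    rintro r (rfl | ⟨E, -, -, -, rfl⟩)
    · exact zero_le_one
    · exact ENNReal.toReal_nonneg
  refine le_csInf ⟨(1:ℝ), Or.inl rfl⟩ ?_
  rintro r (rfl | ⟨E, hE, h1, h2, rfl⟩)
  · have := csInf_le hb (Or.inl rfl)
    unfold hConc
    linarith
  · obtain ⟨a1, a2, a3⟩ := h E hE h1 h2
    have := csInf_le hb (Or.inr ⟨E, hE, a1, a2, rfl⟩)
    unfold hConc
    linarith

lemma LU_close {X : Type*} [MeasurableSpace X] (ν μ : Measure X) [IsFiniteMeasure ν]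
    [IsFiniteMeasure μ] {k : ℕ} (hk : 2 ≤ k) (c : X → Fin k) (hc : Measurable c)
    (η ηhat : X → Fin k → ℝ) (hη : Measurable η) (hηhat : Measurable ηhat)
    (hη01 : ∀ x i, η x i ∈ Set.Icc (0:ℝ) 1) (hηhat01 : ∀ x i, ηhat x i ∈ Set.Icc (0:ℝ) 1)
    (δη : ℝ) (hδη : 0 ≤ δη)
    (hL1 : ∫ x, (∑ i, |η x i - ηhat x i|) ∂μ ≤ δη)
    (E : Set X) (hE : MeasurableSet E) (δ D : ℝ) (hδ : 0 ≤ δ) (hD : 0 < D)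
    (hq : D ≤ (μ E).toReal) (hp : 0 < (ν E).toReal)
    (hpq : |(ν E).toReal - (μ E).toReal| ≤ δ)
    (h : ∀ t : ℚ, |(ν (E ∩ {x | (t:ℝ) < lu c ηhat x})).toReal
      - (μ (E ∩ {x | (t:ℝ) < lu c ηhat x})).toReal| ≤ δ) :
    |LU E ν c ηhat - LU E μ c η| ≤ (4 * δ + δη) / D := by
  have mh := lu_measurable c hc ηhat hηhat
  have m0 := lu_measurable c hc η hη
  have bh := lu_bounds hk c ηhat hηhat01
  have b0 := lu_bounds hk c η hη01
  have ih : ∀ (ρ : Measure X) [IsFiniteMeasure ρ], Integrable (lu c ηhat) ρ := fun ρ _ =>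
    Integrable.of_bound mh.aestronglyMeasurable 2 (Filter.Eventually.of_forall fun x => by
      rw [Real.norm_eq_abs, abs_of_nonneg (bh x).1]; exact (bh x).2)
  have i0 : ∀ (ρ : Measure X) [IsFiniteMeasure ρ], Integrable (lu c η) ρ := fun ρ _ =>
    Integrable.of_bound m0.aestronglyMeasurable 2 (Filter.Eventually.of_forall fun x => by
      rw [Real.norm_eq_abs, abs_of_nonneg (b0 x).1]; exact (b0 x).2)
  have iL : Integrable (fun x => ∑ i, |η x i - ηhat x i|) μ := by
    refine integrable_finsetSum _ fun i _ => ?_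
    have e1 : Measurable fun x => η x i := (measurable_pi_apply i).comp hη
    have e2 : Measurable fun x => ηhat x i := (measurable_pi_apply i).comp hηhat
    refine Integrable.of_bound (e1.sub e2).abs.aestronglyMeasurable 1
      (Filter.Eventually.of_forall fun x => ?_)
    rw [Real.norm_eq_abs, abs_abs, abs_le]
    constructor <;> linarith [(hη01 x i).1, (hη01 x i).2, (hηhat01 x i).1, (hηhat01 x i).2]
  refine aux_arith hD hq hp hδ hδη
    (aux_int ν μ E hE _ mh (fun x => (bh x).1) (fun x => (bh x).2) δ h) ?_ hpq
    (integral_nonneg fun x => (bh x).1) ?_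
  · rw [← integral_sub (i0 _) (ih _)]
    calc |∫ x in E, (lu c η x - lu c ηhat x) ∂μ|
        ≤ ∫ x in E, |lu c η x - lu c ηhat x| ∂μ := abs_integral_le_integral_abs
      _ ≤ ∫ x in E, (∑ i, |η x i - ηhat x i|) ∂μ :=
          integral_mono ((i0 _).sub (ih _)).abs iL.integrableOn
            (fun x => lu_abs_le hk c η ηhat x)
      _ ≤ ∫ x, (∑ i, |η x i - ηhat x i|) ∂μ :=
          setIntegral_le_integral iL (Filter.Eventually.of_forall fun x =>
            Finset.sum_nonneg fun i _ => abs_nonneg _)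
      _ ≤ δη := hL1
  · calc ∫ x in E, lu c ηhat x ∂ν ≤ ∫ x in E, (2:ℝ) ∂ν :=
          integral_mono (ih _) (integrable_const _) (fun x => (bh x).2)
      _ = 2 * (ν E).toReal := by
          rw [setIntegral_const, smul_eq_mul, mul_comm]; rfl

/-- Generalization of concentration under label uncertainty constraints: with probability at
least `1 − 6φ(m, δ) − 2φ_ε(m, δ)` over `S ∼ μ^{⊗m}`,
`h(μ, c, η, α − δ, γ − δ', ε, G) − δ ≤ h(μ̂_S, c, η̂, α, γ, ε, G)
  ≤ h(μ, c, η, α + δ, γ + δ', ε, G) + δ`, where `δ' = (4δ + δ_η)/(α − 2δ)`. -/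
theorem stmt_2 {X : Type*} [PseudoMetricSpace X] [MeasurableSpace X] [BorelSpace X]
    (μ : Measure X) [IsProbabilityMeasure μ]
    (k : ℕ) (hk : 2 ≤ k) (c : X → Fin k) (hc : Measurable c)
    (η ηhat : X → Fin k → ℝ) (hη : Measurable η) (hηhat : Measurable ηhat)
    (hη01 : ∀ x i, η x i ∈ Set.Icc (0:ℝ) 1) (hηhat01 : ∀ x i, ηhat x i ∈ Set.Icc (0:ℝ) 1)
    (δη : ℝ) (hδη : 0 ≤ δη)
    (hL1 : ∫ x, (∑ i, |η x i - ηhat x i|) ∂μ ≤ δη)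
    (G : Set (Set X)) (hGc : G.Countable) (hGm : ∀ E ∈ G, MeasurableSet E)
    (G' : Set (Set X))
    (hG' : G' = G ∪ {A | ∃ E ∈ G, ∃ t : ℚ, A = E ∩ {x | (t : ℝ) < lu c ηhat x}})
    (ε : ℝ) (hε : 0 ≤ ε)
    (Gε : Set (Set X)) (hGε : Gε = {A | ∃ E ∈ G, A = cthickening ε E})
    (φ φε : ℕ → ℝ → ℝ)
    (hφ01 : ∀ m δ, φ m δ ∈ Set.Icc (0:ℝ) 1) (hφε01 : ∀ m δ, φε m δ ∈ Set.Icc (0:ℝ) 1)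
    (hφ : ∀ (m : ℕ) (δ : ℝ), 0 < δ →
      (Measure.pi fun _ : Fin m => μ)
          {S | ∃ A ∈ G', δ ≤ |(empMeasure S A).toReal - (μ A).toReal|}
        ≤ ENNReal.ofReal (φ m δ))
    (hφε : ∀ (m : ℕ) (δ : ℝ), 0 < δ →
      (Measure.pi fun _ : Fin m => μ)
          {S | ∃ A ∈ Gε, δ ≤ |(empMeasure S A).toReal - (μ A).toReal|}
        ≤ ENNReal.ofReal (φε m δ))
    (γ : ℝ) (hγ : 0 ≤ γ) (α : ℝ) (hα : α ∈ Set.Ioc (0:ℝ) 1)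
    (δ : ℝ) (hδ : δ ∈ Set.Ioo 0 (α/2)) (m : ℕ)
    (δ' : ℝ) (hδ' : δ' = (4*δ + δη)/(α - 2*δ)) :
    1 - ENNReal.ofReal (6 * φ m δ + 2 * φε m δ)
      ≤ (Measure.pi fun _ : Fin m => μ)
          {S | hConc μ c η (α - δ) (γ - δ') ε G - δ ≤ hConc (empMeasure S) c ηhat α γ ε G ∧
               hConc (empMeasure S) c ηhat α γ ε G ≤ hConc μ c η (α + δ) (γ + δ') ε G + δ} := by
  obtain ⟨hδ0, hδ2⟩ := hδ
  have hD : 0 < α - 2 * δ := by linarith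
  set P := (Measure.pi fun _ : Fin m => μ) with hP
  set T := {S : Fin m → X |
    hConc μ c η (α - δ) (γ - δ') ε G - δ ≤ hConc (empMeasure S) c ηhat α γ ε G ∧
      hConc (empMeasure S) c ηhat α γ ε G ≤ hConc μ c η (α + δ) (γ + δ') ε G + δ} with hT
  set B1 := {S : Fin m → X | ∃ A ∈ G', δ ≤ |(empMeasure S A).toReal - (μ A).toReal|} with hB1
  set B2 := {S : Fin m → X | ∃ A ∈ Gε, δ ≤ |(empMeasure S A).toReal - (μ A).toReal|} with hB2
  have hcover : (univ : Set (Fin m → X)) ⊆ T ∪ (B1 ∪ B2) := by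
    intro S _
    by_cases hS1 : S ∈ B1
    · exact Or.inr (Or.inl hS1)
    by_cases hS2 : S ∈ B2
    · exact Or.inr (Or.inr hS2)
    left
    simp only [hB1, hB2, mem_ofPred_eq, not_exists, not_and, not_le] at hS1 hS2
    haveI : IsFiniteMeasure (empMeasure S) := ⟨(emp_le_one S univ).trans_lt ENNReal.one_lt_top⟩
    have hG1 : ∀ E ∈ G, |(empMeasure S E).toReal - (μ E).toReal| < δ := fun E hE =>
      hS1 E (by rw [hG']; exact Or.inl hE)
    have hG2 : ∀ E ∈ G, ∀ t : ℚ, |(empMeasure S (E ∩ {x | (t:ℝ) < lu c ηhat x})).toReal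
        - (μ (E ∩ {x | (t:ℝ) < lu c ηhat x})).toReal| ≤ δ := fun E hE t =>
      (hS1 _ (by rw [hG']; exact Or.inr ⟨E, hE, t, rfl⟩)).le
    have hG3 : ∀ E ∈ G, |(empMeasure S (cthickening ε E)).toReal
        - (μ (cthickening ε E)).toReal| < δ := fun E hE =>
      hS2 _ (by rw [hGε]; exact ⟨E, hE, rfl⟩)
    have hLU : ∀ E ∈ G, α - 2 * δ ≤ (μ E).toReal → 0 < (empMeasure S E).toReal →
        |LU E (empMeasure S) c ηhat - LU E μ c η| ≤ δ' := fun E hE h1 h2 => by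
      rw [hδ']
      exact LU_close (empMeasure S) μ hk c hc η ηhat hη hηhat hη01 hηhat01 δη hδη hL1 E
        (hGm E hE) δ _ hδ0.le hD h1 h2 (hG1 E hE).le (hG2 E hE)
    constructor
    · rw [sub_le_iff_le_add]
      apply hConc_le _ _ _ _ _ _ _ _ _ _ _ hδ0.le
      intro E hE h1 h2
      have a1 := abs_lt.mp (hG1 E hE)
      have a3 := abs_lt.mp (hG3 E hE)
      have a2 := abs_le.mp (hLU E hE (by linarith [a1.2]) (by linarith [hα.1]))
      exact ⟨by linarith [a1.2], by linarith [a2.2], by linarith [a3.1]⟩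
    · apply hConc_le _ _ _ _ _ _ _ _ _ _ _ hδ0.le
      intro E hE h1 h2
      have a1 := abs_lt.mp (hG1 E hE)
      have a3 := abs_lt.mp (hG3 E hE)
      have a2 := abs_le.mp (hLU E hE (by linarith) (by linarith [hα.1, a1.1]))
      exact ⟨by linarith [a1.1], by linarith [a2.1], by linarith [a3.2]⟩
  rw [tsub_le_iff_right]
  have p1 := (hφ01 m δ).1
  have p2 := (hφε01 m δ).1
  calc (1 : ℝ≥0∞) = P univ := by rw [hP, measure_univ]
    _ ≤ P (T ∪ (B1 ∪ B2)) := measure_mono hcover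
    _ ≤ P T + (P B1 + P B2) :=
        (measure_union_le _ _).trans (by gcongr; exact measure_union_le _ _)
    _ ≤ P T + (ENNReal.ofReal (φ m δ) + ENNReal.ofReal (φε m δ)) := by
        gcongr
        · exact hφ m δ hδ0
        · exact hφε m δ hδ0
    _ ≤ P T + ENNReal.ofReal (6 * φ m δ + 2 * φε m δ) := by
        rw [← ENNReal.ofReal_add p1 p2]
        gcongr
        · linarith
        · linarith
end
end

section
/- Fix ε ≥ 0 and α ∈ (0,1), and let I = (max(0, 2α − 1), min(2α, 1)). Define g : I → ℝ by g(u) = Φ(Φ⁻¹(u) + ε) + Φ(Φ⁻¹(2α − u) + ε). Then g is monotonically nondecreasing on I ∩ (−∞, α] and monotonically nonincreasing on I ∩ [α, ∞); consequently, the infimum of g over any closed subinterval of I is attained at an endpoint of that subinterval. -/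
open MeasureTheory ProbabilityTheory Metric Set
open scoped ENNReal NNReal

noncomputable section

/-- The cumulative distribution function of the standard normal distribution. -/
noncomputable def Phi (t : ℝ) : ℝ := ∫ s in Set.Iic t, Real.exp (-s^2/2) / Real.sqrt (2*Real.pi)

/-- The inverse of `Phi` on `(0,1)`. -/
noncomputable def PhiInv : ℝ → ℝ := Function.invFun Phi
lemma aux_integrand_eq (s : ℝ) :
    Real.exp (-s^2/2) / Real.sqrt (2*Real.pi) = gaussianPDFReal 0 1 s := by
  rw [gaussianPDFReal]
  simp [div_eq_inv_mul]

lemma aux_Phi_eq_cdf (t : ℝ) : Phi t = cdf (gaussianReal 0 1) t := by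
  rw [cdf_eq_real, Measure.real, gaussianReal_apply_eq_integral 0 one_ne_zero, Phi,
    ENNReal.toReal_ofReal]
  · simp_rw [aux_integrand_eq]
  · exact integral_nonneg fun x => gaussianPDFReal_nonneg 0 1 x

lemma aux_hasDerivAt (t : ℝ) :
    HasDerivAt Phi (Real.exp (-t^2/2) / Real.sqrt (2*Real.pi)) t := by
  have hint : Integrable (fun s : ℝ => Real.exp (-s^2/2) / Real.sqrt (2*Real.pi)) := by
    simp_rw [aux_integrand_eq]
    exact integrable_gaussianPDFReal 0 1
  have hc : Continuous (fun s : ℝ => Real.exp (-s^2/2) / Real.sqrt (2*Real.pi)) := by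
    fun_prop
  have h : Phi = fun t => Phi 0 +
      ∫ s in (0:ℝ)..t, Real.exp (-s^2/2) / Real.sqrt (2*Real.pi) := by
    funext t
    rw [← intervalIntegral.integral_Iic_sub_Iic hint.integrableOn hint.integrableOn]
    simp only [Phi]
    ring
  rw [h]
  exact (intervalIntegral.integral_hasDerivAt_right (hc.intervalIntegrable _ _)
    (hc.stronglyMeasurableAtFilter _ _) hc.continuousAt).const_add _

lemma aux_strictMono : StrictMono Phi := by
  apply strictMono_of_deriv_pos
  intro t
  rw [(aux_hasDerivAt t).deriv]
  positivity

lemma aux_Phi_PhiInv {u : ℝ} (hu : u ∈ Set.Ioo (0:ℝ) 1) : Phi (PhiInv u) = u := by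
  apply Function.invFun_eq
  have hc : Continuous Phi :=
    continuous_iff_continuousAt.2 fun t => (aux_hasDerivAt t).continuousAt
  have h0 := tendsto_cdf_atBot (gaussianReal 0 1)
  have h1 := tendsto_cdf_atTop (gaussianReal 0 1)
  obtain ⟨a, ha⟩ := (h0.eventually (gt_mem_nhds hu.1)).exists
  obtain ⟨b, hb⟩ := (h1.eventually (lt_mem_nhds hu.2)).exists
  rw [← aux_Phi_eq_cdf] at ha hb
  exact mem_range_of_exists_le_of_exists_ge hc ⟨a, ha.le⟩ ⟨b, hb.le⟩

lemma aux_key {ε : ℝ} (hε : 0 ≤ ε) {x x' y y' : ℝ} (h1 : x ≤ x') (h2 : x' ≤ y) (h3 : y ≤ y')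
    (h : Phi x' - Phi x = Phi y' - Phi y) :
    Phi (y' + ε) - Phi (y + ε) ≤ Phi (x' + ε) - Phi (x + ε) := by
  set c := Real.exp (-x' * ε - ε^2/2) with hc
  have hd : ∀ s : ℝ, HasDerivAt (fun s => Phi (s + ε) - c * Phi s)
      (Real.exp (-s^2/2) / Real.sqrt (2*Real.pi) * (Real.exp (-s * ε - ε^2/2) - c)) s := by
    intro s
    have := ((aux_hasDerivAt (s + ε)).comp_add_const s ε).sub ((aux_hasDerivAt s).const_mul c)
    refine HasDerivAt.congr_deriv this ?_
    have e : Real.exp (-(s+ε)^2/2) = Real.exp (-s^2/2) * Real.exp (-s * ε - ε^2/2) := by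
      rw [← Real.exp_add]
      congr 1
      ring
    rw [e]
    ring
  have hcont : Continuous (fun s => Phi (s + ε) - c * Phi s) :=
    continuous_iff_continuousAt.2 fun t => (hd t).continuousAt
  have hm : MonotoneOn (fun s => Phi (s + ε) - c * Phi s) (Set.Iic x') := by
    apply monotoneOn_of_deriv_nonneg (convex_Iic _) hcont.continuousOn
      (fun s _ => (hd s).differentiableAt.differentiableWithinAt)
    intro s hs
    rw [interior_Iic] at hs
    rw [(hd s).deriv]
    apply mul_nonneg (by positivity)
    rw [sub_nonneg, hc, Real.exp_le_exp]
    nlinarith [mul_le_mul_of_nonneg_right (le_of_lt (Set.mem_Iio.1 hs)) hε]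
  have ha : AntitoneOn (fun s => Phi (s + ε) - c * Phi s) (Set.Ici x') := by
    apply antitoneOn_of_deriv_nonpos (convex_Ici _) hcont.continuousOn
      (fun s _ => (hd s).differentiableAt.differentiableWithinAt)
    intro s hs
    rw [interior_Ici] at hs
    rw [(hd s).deriv]
    apply mul_nonpos_of_nonneg_of_nonpos (by positivity)
    rw [sub_nonpos, hc, Real.exp_le_exp]
    nlinarith [mul_le_mul_of_nonneg_right (le_of_lt (Set.mem_Ioi.1 hs)) hε]
  have A := hm (Set.mem_Iic.2 h1) (Set.mem_Iic.2 le_rfl) h1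
  have B := ha (Set.mem_Ici.2 h2) (Set.mem_Ici.2 (h2.trans h3)) h3
  simp only at A B
  have e : c * Phi x' - c * Phi x = c * Phi y' - c * Phi y := by
    rw [← mul_sub, ← mul_sub, h]
  linarith

/-- The function `g(u) = Φ(Φ⁻¹(u) + ε) + Φ(Φ⁻¹(2α − u) + ε)` is monotonically nondecreasing on
`I ∩ (−∞, α]` and nonincreasing on `I ∩ [α, ∞)`; consequently its infimum over any closed
subinterval of `I` is attained at an endpoint of that subinterval. -/
theorem stmt_11 (ε : ℝ) (hε : 0 ≤ ε) (α : ℝ) (hα : α ∈ Set.Ioo (0:ℝ) 1)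
    (I : Set ℝ) (hI : I = Set.Ioo (max 0 (2*α - 1)) (min (2*α) 1))
    (g : ℝ → ℝ)
    (hg : ∀ u ∈ I, g u = Phi (PhiInv u + ε) + Phi (PhiInv (2*α - u) + ε)) :
    MonotoneOn g (I ∩ Set.Iic α) ∧ AntitoneOn g (I ∩ Set.Ici α) ∧
    ∀ a b : ℝ, a ≤ b → Set.Icc a b ⊆ I →
      IsLeast (g '' Set.Icc a b) (min (g a) (g b)) := by
  have hu01 : ∀ u ∈ I, u ∈ Set.Ioo (0:ℝ) 1 ∧ 2*α - u ∈ Set.Ioo (0:ℝ) 1 ∧ 2*α - u ∈ I := by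
    intro u hu
    rw [hI] at hu ⊢
    simp only [Set.mem_Ioo, max_lt_iff, lt_min_iff] at hu ⊢
    obtain ⟨⟨_, _⟩, _, _⟩ := hu
    refine ⟨⟨?_, ?_⟩, ⟨?_, ?_⟩, ⟨?_, ?_⟩, ?_, ?_⟩ <;> linarith
  have hsym : ∀ u ∈ I, g (2*α - u) = g u := by
    intro u hu
    rw [hg u hu, hg _ (hu01 u hu).2.2, sub_sub_cancel, add_comm]
  have hle : ∀ u ∈ Set.Ioo (0:ℝ) 1, ∀ v ∈ Set.Ioo (0:ℝ) 1, u ≤ v → PhiInv u ≤ PhiInv v := by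
    intro u hu v hv h
    rw [← aux_strictMono.le_iff_le, aux_Phi_PhiInv hu, aux_Phi_PhiInv hv]
    exact h
  have hmono : MonotoneOn g (I ∩ Set.Iic α) := by
    rintro u ⟨hu, huα⟩ v ⟨hv, hvα⟩ huv
    rw [Set.mem_Iic] at huα hvα
    obtain ⟨u1, u2, -⟩ := hu01 u hu
    obtain ⟨v1, v2, -⟩ := hu01 v hv
    rw [hg u hu, hg v hv]
    have := aux_key hε (hle u u1 v v1 huv) (hle v v1 _ v2 (by linarith))
      (hle _ v2 _ u2 (by linarith))
      (by rw [aux_Phi_PhiInv u1, aux_Phi_PhiInv v1, aux_Phi_PhiInv u2, aux_Phi_PhiInv v2]; ring)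
    linarith
  have hanti : AntitoneOn g (I ∩ Set.Ici α) := by
    rintro u ⟨hu, huα⟩ v ⟨hv, hvα⟩ huv
    rw [Set.mem_Ici] at huα hvα
    rw [← hsym u hu, ← hsym v hv]
    exact hmono ⟨(hu01 v hv).2.2, Set.mem_Iic.2 (by linarith)⟩
      ⟨(hu01 u hu).2.2, Set.mem_Iic.2 (by linarith)⟩ (by linarith)
  refine ⟨hmono, hanti, ?_⟩
  intro a b hab hsub
  have haI := hsub (Set.left_mem_Icc.2 hab)
  have hbI := hsub (Set.right_mem_Icc.2 hab)
  constructor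
  · rcases min_choice (g a) (g b) with h | h <;> rw [h]
    · exact Set.mem_image_of_mem g (Set.left_mem_Icc.2 hab)
    · exact Set.mem_image_of_mem g (Set.right_mem_Icc.2 hab)
  · rintro _ ⟨u, hu, rfl⟩
    rcases le_total u α with h | h
    · exact (min_le_left _ _).trans
        (hmono ⟨haI, hu.1.trans h⟩ ⟨hsub hu, h⟩ hu.1)
    · exact (min_le_right _ _).trans
        (hanti ⟨hsub hu, h⟩ ⟨hbI, h.trans hu.2⟩ hu.2)
end
end
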